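/- For integers t > s > 2 with gcd(s,t) > 1, C(s+t+1,2) − (2s+2t−2) ≤ wsat(s+t+1, K_{s,t}) ≤ C(s+t+1,2) − (2s+2t−3). -/

import Mathlib

open SimpleGraph

/-- `G` contains a copy of `F`. -/
def ContainsCopy {W V : Type*} (F : SimpleGraph W) (G : SimpleGraph V) : Prop :=
  ∃ f : W ↪ V, ∀ a b, F.Adj a b → G.Adj (f a) (f b)

/-- One step of the weak saturation process: add one missing edge `e` so that the new
graph contains a copy of `F` through `e`. -/
def AddStep {W V : Type*} (F : SimpleGraph W) (G G' : SimpleGraph V) : Prop :=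
  ∃ e, e ∉ G.edgeSet ∧ G'.edgeSet = insert e G.edgeSet ∧
    ∃ f : W ↪ V, (∀ a b, F.Adj a b → G'.Adj (f a) (f b)) ∧
      ∃ a b, F.Adj a b ∧ s(f a, f b) = e

/-- `G` is weakly `F`-saturated. -/
def IsWeaklySaturated {W V : Type*} (F : SimpleGraph W) (G : SimpleGraph V) : Prop :=
  ¬ ContainsCopy F G ∧
  ∃ (m : ℕ) (c : ℕ → SimpleGraph V), c 0 = G ∧ c m = ⊤ ∧
    ∀ i < m, AddStep F (c i) (c (i + 1))

/-- The weak saturation number `wsat(n, F)`. -/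
noncomputable def wsat {W : Type*} (n : ℕ) (F : SimpleGraph W) : ℕ :=
  sInf {m | ∃ G : SimpleGraph (Fin n), IsWeaklySaturated F G ∧ G.edgeSet.ncard = m}

set_option linter.unusedSectionVars false

section LowerBound

variable {V : Type*} [Fintype V] [DecidableEq V]

open Classical in
/-- number of edges of `H` inside `X` -/
noncomputable def iE (H : SimpleGraph V) (X : Finset V) : ℕ :=
  (X.sym2.filter (fun e => e ∈ H.edgeSet)).card

/-- Removing the edge `ab` from `H` gives the second graph, and after deleting `w`, `ab` is the only edge between
`S` and `T`. -/
structure Split (s t : ℕ) (H H' : SimpleGraph V) (a b w : V) (S T : Finset V) : Prop where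
  hS : S.card = s
  hT : T.card = t
  ha : a ∈ S
  hb : b ∈ T
  hwS : w ∉ S
  hwT : w ∉ T
  disj : Disjoint S T
  cover : ∀ x, x ∈ S ∨ x ∈ T ∨ x = w
  hab : H.Adj a b
  cross : ∀ x ∈ S, ∀ y ∈ T, ¬ H'.Adj x y
  del : ∀ x y, H.Adj x y ↔ H'.Adj x y ∨ s(x, y) = s(a, b)

lemma iE_not_mem {s t : ℕ} {H H' : SimpleGraph V} {a b w : V} {S T : Finset V}
    (h : Split s t H H' a b w S T) (X : Finset V) (hX : ¬ (a ∈ X ∧ b ∈ X)) :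
    iE H X ≤ iE H' X := by
  classical
  unfold iE
  apply Finset.card_le_card
  intro e
  induction e using Sym2.ind with
  | _ x y =>
    simp only [Finset.mem_filter, Finset.mk_mem_sym2_iff, SimpleGraph.mem_edgeSet]
    rintro ⟨⟨hx, hy⟩, hxy⟩
    refine ⟨⟨hx, hy⟩, ?_⟩
    rcases (h.del x y).1 hxy with h1 | h1
    · exact h1
    · exfalso
      rcases Sym2.eq_iff.1 h1 with ⟨rfl, rfl⟩ | ⟨rfl, rfl⟩ <;> tauto

lemma iE_inter {s t : ℕ} {H H' : SimpleGraph V} {a b w : V} {S T : Finset V}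
    (h : Split s t H H' a b w S T) (X : Finset V) :
    iE H' X ≤ iE H' (X ∩ insert w S) + iE H' (X ∩ insert w T) := by
  classical
  unfold iE
  refine le_trans (Finset.card_le_card ?_) (Finset.card_union_le _ _)
  intro e
  induction e using Sym2.ind with
  | _ x y =>
    simp only [Finset.mem_filter, Finset.mk_mem_sym2_iff, SimpleGraph.mem_edgeSet,
      Finset.mem_union, Finset.mem_inter, Finset.mem_insert]
    rintro ⟨⟨hx, hy⟩, hxy⟩
    have h1 := h.cross x
    have h2 := h.cross y
    have h3 := h.cover x
    have h4 := h.cover y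
    have h5 : ¬ (x ∈ S ∧ y ∈ T) := fun hh => h.cross x hh.1 y hh.2 hxy
    have h6 : ¬ (y ∈ S ∧ x ∈ T) := fun hh => h.cross y hh.1 x hh.2 hxy.symm
    tauto

lemma iE_del {s t : ℕ} {H H' : SimpleGraph V} {a b w : V} {S T : Finset V}
    (h : Split s t H H' a b w S T) (X : Finset V) :
    iE H X ≤ iE H' X + 1 := by
  classical
  unfold iE
  refine le_trans (Finset.card_le_card (t := insert s(a, b) (X.sym2.filter (fun e => e ∈ H'.edgeSet))) ?_)
    (Finset.card_insert_le _ _)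
  intro e
  induction e using Sym2.ind with
  | _ x y =>
    simp only [Finset.mem_filter, Finset.mk_mem_sym2_iff, SimpleGraph.mem_edgeSet,
      Finset.mem_insert]
    rintro ⟨⟨hx, hy⟩, hxy⟩
    have := (h.del x y).1 hxy
    tauto

lemma iE_small (H : SimpleGraph V) (X : Finset V) (hX : X.card ≤ 1) : iE H X = 0 := by
  classical
  unfold iE
  rw [Finset.card_eq_zero, Finset.filter_eq_empty_iff]
  intro e
  induction e using Sym2.ind with
  | _ x y =>
    simp only [Finset.mk_mem_sym2_iff, SimpleGraph.mem_edgeSet]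
    rintro ⟨hx, hy⟩ hxy
    have := Finset.card_le_one.1 hX x hx y hy
    subst this
    exact hxy.ne rfl

lemma iE_bot (X : Finset V) : iE (⊥ : SimpleGraph V) X = 0 := by
  classical
  unfold iE
  simp

lemma card_inter_sum {s t : ℕ} {H H' : SimpleGraph V} {a b w : V} {S T : Finset V}
    (h : Split s t H H' a b w S T) (X : Finset V) :
    (X ∩ insert w S).card + (X ∩ insert w T).card = X.card + (if w ∈ X then 1 else 0) := by
  classical
  rw [← Finset.card_union_add_card_inter]
  congr 1
  · congr 1
    ext x
    have := h.cover x
    simp only [Finset.mem_union, Finset.mem_inter, Finset.mem_insert]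
    tauto
  · have hd := Finset.disjoint_left.1 h.disj
    split_ifs with hw
    · rw [Finset.card_eq_one]
      refine ⟨w, ?_⟩
      ext x
      have := @hd x
      simp only [Finset.mem_inter, Finset.mem_insert, Finset.mem_singleton]
      constructor
      · tauto
      · rintro rfl; tauto
    · rw [Finset.card_eq_zero, Finset.eq_empty_iff_forall_notMem]
      intro x
      have := @hd x
      simp only [Finset.mem_inter, Finset.mem_insert]
      rintro ⟨⟨h1, h2⟩, -, h3⟩
      have : x ≠ w := by rintro rfl; exact hw h1
      tauto

/-- (2,3)-sparsity -/
def Sparse (H : SimpleGraph V) : Prop := ∀ X : Finset V, 2 ≤ X.card → iE H X + 3 ≤ 2 * X.card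

lemma one_lt_of_two {X : Finset V} {a b : V} (ha : a ∈ X) (hb : b ∈ X) (hab : a ≠ b) :
    2 ≤ X.card := Finset.one_lt_card.2 ⟨a, ha, b, hb, hab⟩

lemma sparse_step {s t : ℕ} {H H' : SimpleGraph V} {a b w : V} {S T : Finset V}
    (h : Split s t H H' a b w S T) (hs : Sparse H') : Sparse H := by
  intro X hX
  by_cases hab : a ∈ X ∧ b ∈ X
  · obtain ⟨ha, hb⟩ := hab
    have h1 := iE_del h X
    have h2 := iE_inter h X
    have h3 := card_inter_sum h X
    have ha' : a ∈ X ∩ insert w S := by simp [ha, h.ha]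
    have hb' : b ∈ X ∩ insert w T := by simp [hb, h.hb]
    have hs1 := hs (X ∩ insert w S)
    have hs2 := hs (X ∩ insert w T)
    have hz1 := iE_small H' (X ∩ insert w S)
    have hz2 := iE_small H' (X ∩ insert w T)
    have hp1 := Finset.card_pos.2 ⟨a, ha'⟩
    have hp2 := Finset.card_pos.2 ⟨b, hb'⟩
    by_cases hw : w ∈ X
    · have hq1 := one_lt_of_two ha' (b := w) (by simp [hw]) (by rintro rfl; exact h.hwS h.ha)
      have hq2 := one_lt_of_two hb' (b := w) (by simp [hw]) (by rintro rfl; exact h.hwT h.hb)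
      rw [if_pos hw] at h3
      have := hs1 hq1
      have := hs2 hq2
      omega
    · rw [if_neg hw] at h3
      by_cases c1 : (X ∩ insert w S).card ≤ 1 <;> by_cases c2 : (X ∩ insert w T).card ≤ 1
      · have := hz1 c1; have := hz2 c2; omega
      · have := hz1 c1; have := hs2 (by omega); omega
      · have := hs1 (by omega); have := hz2 c2; omega
      · have := hs1 (by omega); have := hs2 (by omega); omega
  · exact le_trans (Nat.add_le_add_right (iE_not_mem h X hab) 3) (hs X hX)

/-- rank of `X` in the family -/
def fr (F : Multiset (Finset V)) (X : Finset V) : ℕ := (F.map (fun Y => (Y ∩ X).card - 1)).sum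

/-- A hypertree of blocks with weights divisible by `g`. -/
structure Hyp (g : ℕ) (F : Multiset (Finset V)) : Prop where
  two : ∀ Y ∈ F, 2 ≤ Y.card
  dvd : ∀ Y ∈ F, g ∣ Y.card - 1
  acyc : ∀ X : Finset V, X.Nonempty → fr F X ≤ X.card - 1
  full : fr F Finset.univ = Fintype.card V - 1

def NoTight (g : ℕ) (H : SimpleGraph V) : Prop :=
  ∀ F : Multiset (Finset V), Hyp g F → ∃ Y ∈ F, iE H Y + 3 < 2 * Y.card

lemma noTight_bot (g : ℕ) (hV : 2 ≤ Fintype.card V) : NoTight g (⊥ : SimpleGraph V) := by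
  intro F hF
  have : F ≠ 0 := by
    rintro rfl
    have := hF.full
    simp [fr] at this
    omega
  obtain ⟨Y, hY⟩ := Multiset.exists_mem_of_ne_zero this
  refine ⟨Y, hY, ?_⟩
  have := hF.two Y hY
  rw [iE_bot]; omega

lemma fr_cons (Y : Finset V) (F : Multiset (Finset V)) (X : Finset V) :
    fr (Y ::ₘ F) X = ((Y ∩ X).card - 1) + fr F X := by simp [fr]

lemma noTight_step {g s t : ℕ} (hg : 2 ≤ g) (hgs : g ∣ s) (hgt : g ∣ t)
    {H H' : SimpleGraph V} {a b w : V} {S T : Finset V}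
    (h : Split s t H H' a b w S T) (hs : Sparse H') (hn : NoTight g H') : NoTight g H := by
  intro F hF
  by_contra! hcon
  have hne : a ≠ b := h.hab.ne
  have hwa : a ≠ w := by rintro rfl; exact h.hwS h.ha
  have hwb : b ≠ w := by rintro rfl; exact h.hwT h.hb
  by_cases hex : ∃ Y ∈ F, a ∈ Y ∧ b ∈ Y
  · obtain ⟨Y, hY, ha, hb⟩ := hex
    obtain ⟨F', rfl⟩ := Multiset.exists_cons_of_mem hY
    -- no other block contains the edge
    have hother : ∀ Z ∈ F', ¬ (a ∈ Z ∧ b ∈ Z) := by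
      rintro Z hZ ⟨haZ, hbZ⟩
      obtain ⟨F'', rfl⟩ := Multiset.exists_cons_of_mem hZ
      have := hF.acyc {a, b} ⟨a, by simp⟩
      rw [fr_cons, fr_cons, Finset.card_pair hne] at this
      have h1 := one_lt_of_two (X := Y ∩ {a, b}) (a := a) (b := b) (by simp [ha]) (by simp [hb]) hne
      have h2 := one_lt_of_two (X := Z ∩ {a, b}) (a := a) (b := b) (by simp [haZ]) (by simp [hbZ]) hne
      omega
    have htight : ∀ Z ∈ F', 2 * Z.card ≤ iE H' Z + 3 := fun Z hZ =>
      le_trans (hcon Z (by simp [hZ])) (Nat.add_le_add_right (iE_not_mem h Z (hother Z hZ)) 3)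
    have hside : ∀ Z ∈ F', Z ⊆ insert w S ∨ Z ⊆ insert w T := by
      intro Z hZ
      by_contra! hc
      obtain ⟨hc1, hc2⟩ := hc
      obtain ⟨x, hxZ, hx⟩ := Finset.not_subset.1 hc1
      obtain ⟨y, hyZ, hy⟩ := Finset.not_subset.1 hc2
      have hxT : x ∈ T := by
        have := h.cover x; simp at hx; tauto
      have hyS : y ∈ S := by
        have := h.cover y; simp at hy; tauto
      have hxw : x ≠ w := by rintro rfl; exact h.hwT hxT
      have hyw : y ≠ w := by rintro rfl; exact h.hwS hyS
      have hx' : x ∈ Z ∩ insert w T := by simp [hxZ, hxT]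
      have hy' : y ∈ Z ∩ insert w S := by simp [hyZ, hyS]
      have h2 := iE_inter h Z
      have h3 := card_inter_sum h Z
      have hs1 := hs (Z ∩ insert w S)
      have hs2 := hs (Z ∩ insert w T)
      have hz1 := iE_small H' (Z ∩ insert w S)
      have hz2 := iE_small H' (Z ∩ insert w T)
      have hp1 := Finset.card_pos.2 ⟨y, hy'⟩
      have hp2 := Finset.card_pos.2 ⟨x, hx'⟩
      have ht := htight Z hZ
      by_cases hw : w ∈ Z
      · have hq1 := one_lt_of_two hy' (b := w) (by simp [hw]) hyw
        have hq2 := one_lt_of_two hx' (b := w) (by simp [hw]) hxw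
        rw [if_pos hw] at h3
        have := hs1 hq1
        have := hs2 hq2
        omega
      · rw [if_neg hw] at h3
        by_cases c1 : (Z ∩ insert w S).card ≤ 1 <;> by_cases c2 : (Z ∩ insert w T).card ≤ 1
        · have := hz1 c1; have := hz2 c2; omega
        · have := hz1 c1; have := hs2 (by omega); omega
        · have := hs1 (by omega); have := hz2 c2; omega
        · have := hs1 (by omega); have := hs2 (by omega); omega
    have hY3 : 3 ≤ Y.card := by
      have h1 := hF.two Y (by simp)
      have h2 := Nat.le_of_dvd (by omega) (hF.dvd Y (by simp))
      omega
    have hYt := hcon Y (by simp)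
    have h1 := iE_del h Y
    have h2 := iE_inter h Y
    have h3 := card_inter_sum h Y
    set Y1 := Y ∩ insert w S with hY1
    set Y2 := Y ∩ insert w T with hY2
    have ha' : a ∈ Y1 := by simp [hY1, ha, h.ha]
    have hb' : b ∈ Y2 := by simp [hY2, hb, h.hb]
    have hs1 := hs Y1
    have hs2 := hs Y2
    have hz1 := iE_small H' Y1
    have hz2 := iE_small H' Y2
    have hp1 := Finset.card_pos.2 ⟨a, ha'⟩
    have hp2 := Finset.card_pos.2 ⟨b, hb'⟩
    have hw : w ∈ Y := by
      by_contra hw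
      rw [if_neg hw] at h3
      by_cases c1 : Y1.card ≤ 1 <;> by_cases c2 : Y2.card ≤ 1
      · have := hz1 c1; have := hz2 c2; omega
      · have := hz1 c1; have := hs2 (by omega); omega
      · have := hs1 (by omega); have := hz2 c2; omega
      · have := hs1 (by omega); have := hs2 (by omega); omega
    rw [if_pos hw] at h3
    have hw1 : w ∈ Y1 := by simp [hY1, hw]
    have hw2 : w ∈ Y2 := by simp [hY2, hw]
    have hq1 := one_lt_of_two ha' hw1 hwa
    have hq2 := one_lt_of_two hb' hw2 hwb
    have hs1 := hs1 hq1
    have hs2 := hs2 hq2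
    -- the new family
    have hfr : ∀ X, fr (Y1 ::ₘ Y2 ::ₘ F') X ≤ fr (Y ::ₘ F') X := by
      intro X
      rw [fr_cons, fr_cons, fr_cons, ← add_assoc]
      apply Nat.add_le_add_right
      have h4 := card_inter_sum h (Y ∩ X)
      have e1 : Y ∩ X ∩ insert w S = Y1 ∩ X := by rw [hY1, Finset.inter_right_comm]
      have e2 : Y ∩ X ∩ insert w T = Y2 ∩ X := by rw [hY2, Finset.inter_right_comm]
      rw [e1, e2] at h4
      by_cases hwX : w ∈ X
      · have := Finset.card_pos.2 (⟨w, by simp [hw1, hwX]⟩ : (Y1 ∩ X).Nonempty)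
        have := Finset.card_pos.2 (⟨w, by simp [hw2, hwX]⟩ : (Y2 ∩ X).Nonempty)
        rw [if_pos (by simp [hw, hwX])] at h4
        omega
      · rw [if_neg (by simp [hwX])] at h4
        omega
    have hacyc : ∀ X : Finset V, X.Nonempty → fr (Y1 ::ₘ Y2 ::ₘ F') X ≤ X.card - 1 :=
      fun X hX => le_trans (hfr X) (hF.acyc X hX)
    have hfull : fr (Y1 ::ₘ Y2 ::ₘ F') Finset.univ = Fintype.card V - 1 := by
      have := hF.full
      rw [fr_cons] at this
      rw [fr_cons, fr_cons]
      simp only [Finset.inter_univ] at this ⊢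
      omega
    have hcardV : Fintype.card V = s + t + 1 := by
      have := card_inter_sum h Finset.univ
      simp only [Finset.univ_inter, Finset.mem_univ, if_true, Finset.card_univ] at this
      rw [Finset.card_insert_of_notMem h.hwS, Finset.card_insert_of_notMem h.hwT, h.hS, h.hT] at this
      omega
    -- single-block facts
    have hone : ∀ Z : Finset V, Z ⊆ insert w S →
        (Z ∩ insert w S).card - 1 = Z.card - 1 ∧ (Z ∩ insert w T).card - 1 = 0 := by
      intro Z hZ
      have e1 : Z ∩ insert w S = Z := Finset.inter_eq_left.2 hZ
      have h4 := card_inter_sum h Z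
      rw [e1] at h4 ⊢
      refine ⟨rfl, ?_⟩
      split_ifs at h4 <;> omega
    have htwo : ∀ Z : Finset V, Z ⊆ insert w T →
        (Z ∩ insert w T).card - 1 = Z.card - 1 ∧ (Z ∩ insert w S).card - 1 = 0 := by
      intro Z hZ
      have e1 : Z ∩ insert w T = Z := Finset.inter_eq_left.2 hZ
      have h4 := card_inter_sum h Z
      rw [e1] at h4 ⊢
      refine ⟨rfl, ?_⟩
      split_ifs at h4 <;> omega
    have hsum : ∀ F0 : Multiset (Finset V), (∀ Z ∈ F0, Z ⊆ insert w S ∨ Z ⊆ insert w T) →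
        fr F0 (insert w S) + fr F0 (insert w T) = fr F0 Finset.univ := by
      intro F0
      induction F0 using Multiset.induction_on with
      | empty => intro _; simp [fr]
      | cons Z F0 ih =>
        intro hh
        have ih := ih (fun Z' hZ' => hh Z' (by simp [hZ']))
        rw [fr_cons, fr_cons, fr_cons, Finset.inter_univ]
        rcases hh Z (by simp) with hZ | hZ
        · have := hone Z hZ; omega
        · have := htwo Z hZ; omega
    have hdv : ∀ F0 : Multiset (Finset V), (∀ Z ∈ F0, Z ⊆ insert w S ∨ Z ⊆ insert w T) →
        (∀ Z ∈ F0, g ∣ Z.card - 1) → g ∣ fr F0 (insert w S) ∧ g ∣ fr F0 (insert w T) := by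
      intro F0
      induction F0 using Multiset.induction_on with
      | empty => intro _ _; simp [fr]
      | cons Z F0 ih =>
        intro hh hd
        have ih := ih (fun Z' hZ' => hh Z' (by simp [hZ'])) (fun Z' hZ' => hd Z' (by simp [hZ']))
        have hdZ := hd Z (by simp)
        rw [fr_cons, fr_cons]
        rcases hh Z (by simp) with hZ | hZ
        · rw [(hone Z hZ).1, (hone Z hZ).2, zero_add]
          exact ⟨dvd_add hdZ ih.1, ih.2⟩
        · rw [(htwo Z hZ).1, (htwo Z hZ).2, zero_add]
          exact ⟨ih.1, dvd_add hdZ ih.2⟩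
    have hsub1 : Y1 ⊆ insert w S := Finset.inter_subset_right
    have hsub2 : Y2 ⊆ insert w T := Finset.inter_subset_right
    have hsumN := hsum (Y1 ::ₘ Y2 ::ₘ F') (by
      intro Z hZ
      simp only [Multiset.mem_cons] at hZ
      rcases hZ with rfl | rfl | hZ
      · exact Or.inl hsub1
      · exact Or.inr hsub2
      · exact hside Z hZ)
    rw [hfull, hcardV] at hsumN
    have b1 := hacyc (insert w S) ⟨w, by simp⟩
    have b2 := hacyc (insert w T) ⟨w, by simp⟩
    rw [Finset.card_insert_of_notMem h.hwS, h.hS] at b1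
    rw [Finset.card_insert_of_notMem h.hwT, h.hT] at b2
    have c1 : fr (Y1 ::ₘ Y2 ::ₘ F') (insert w S) = s := by omega
    have c2 : fr (Y1 ::ₘ Y2 ::ₘ F') (insert w T) = t := by omega
    obtain ⟨d1, d2⟩ := hdv F' hside (fun Z hZ => hF.dvd Z (by simp [hZ]))
    rw [fr_cons, fr_cons, (hone Y1 hsub1).1, (htwo Y2 hsub2).2, zero_add] at c1
    rw [fr_cons, fr_cons, (hone Y1 hsub1).2, (htwo Y2 hsub2).1, zero_add] at c2
    have e1 : g ∣ Y1.card - 1 := (Nat.dvd_add_left d1).1 (c1 ▸ hgs)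
    have e2 : g ∣ Y2.card - 1 := (Nat.dvd_add_left d2).1 (c2 ▸ hgt)
    obtain ⟨Z, hZ, hZt⟩ := hn (Y1 ::ₘ Y2 ::ₘ F') ⟨by
        intro Z hZ
        simp only [Multiset.mem_cons] at hZ
        rcases hZ with rfl | rfl | hZ
        · exact hq1
        · exact hq2
        · exact hF.two Z (by simp [hZ]), by
        intro Z hZ
        simp only [Multiset.mem_cons] at hZ
        rcases hZ with rfl | rfl | hZ
        · exact e1
        · exact e2
        · exact hF.dvd Z (by simp [hZ]), hacyc, hfull⟩
    simp only [Multiset.mem_cons] at hZ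
    rcases hZ with rfl | rfl | hZ
    · omega
    · omega
    · have := htight Z hZ; omega
  · push Not at hex
    obtain ⟨Y, hY, hYt⟩ := hn F hF
    have := iE_not_mem h Y (fun hh => hex Y hY hh.1 hh.2)
    have := hcon Y hY
    omega

lemma split_of_addStep {s t : ℕ} (hV : Fintype.card V = s + t + 1) {G G' : SimpleGraph V}
    (h : AddStep (completeBipartiteGraph (Fin s) (Fin t)) G G') :
    ∃ a b w S T, Split s t Gᶜ G'ᶜ a b w S T := by
  obtain ⟨e, he, hG', f, hf, a0, b0, hab0, hfe⟩ := h
  -- wlog a0 on the left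
  have hadj : ∀ x y, G'.Adj x y ↔ s(x, y) = e ∨ G.Adj x y := by
    intro x y
    rw [← SimpleGraph.mem_edgeSet, hG', Set.mem_insert_iff, SimpleGraph.mem_edgeSet]
  obtain ⟨i, j, hij⟩ : ∃ (i : Fin s) (j : Fin t), s(f (Sum.inl i), f (Sum.inr j)) = e := by
    rcases a0 with i | i <;> rcases b0 with j | j
    · simp at hab0
    · exact ⟨i, j, hfe⟩
    · exact ⟨j, i, by rw [Sym2.eq_swap]; exact hfe⟩
    · simp at hab0
  subst hij
  set S : Finset V := Finset.univ.map (Function.Embedding.inl.trans f) with hSdef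
  set T : Finset V := Finset.univ.map (Function.Embedding.inr.trans f) with hTdef
  have mS : ∀ x, x ∈ S ↔ ∃ i, f (Sum.inl i) = x := by intro x; simp [hSdef]
  have mT : ∀ x, x ∈ T ↔ ∃ i, f (Sum.inr i) = x := by intro x; simp [hTdef]
  have cS : S.card = s := by simp [hSdef]
  have cT : T.card = t := by simp [hTdef]
  have hdisj : Disjoint S T := by
    rw [Finset.disjoint_left]
    intro x hx hx'
    obtain ⟨i, hi⟩ := (mS x).1 hx
    obtain ⟨j, hj⟩ := (mT x).1 hx'
    have := f.injective (hi.trans hj.symm)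
    simp at this
  have hc : (S ∪ T)ᶜ.card = 1 := by
    rw [Finset.card_compl, Finset.card_union_of_disjoint hdisj, cS, cT, hV]; omega
  obtain ⟨w, hw⟩ := Finset.card_eq_one.1 hc
  have hw' : ∀ x, x ∉ S ∪ T ↔ x = w := by
    intro x
    rw [← Finset.mem_compl, hw, Finset.mem_singleton]
  have hww := (hw' w).2 rfl
  rw [Finset.mem_union, not_or] at hww
  have hne : f (Sum.inl i) ≠ f (Sum.inr j) := fun hh => by
    have := f.injective hh
    simp at this
  refine ⟨f (Sum.inl i), f (Sum.inr j), w, S, T, cS, cT, (mS _).2 ⟨i, rfl⟩, (mT _).2 ⟨j, rfl⟩,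
    hww.1, hww.2, hdisj, ?_, ?_, ?_, ?_⟩
  · intro x
    have := hw' x
    rw [Finset.mem_union] at this
    tauto
  · rw [SimpleGraph.compl_adj]
    exact ⟨hne, he⟩
  · intro x hx y hy hxy
    obtain ⟨i', rfl⟩ := (mS x).1 hx
    obtain ⟨j', rfl⟩ := (mT y).1 hy
    exact hxy.2 (hf _ _ (by simp))
  · intro x y
    rw [SimpleGraph.compl_adj, SimpleGraph.compl_adj, hadj]
    by_cases hx : s(x, y) = s(f (Sum.inl i), f (Sum.inr j))
    · have h1 : ¬ G.Adj x y := by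
        rw [← SimpleGraph.mem_edgeSet, hx]; exact he
      have h2 : x ≠ y := by
        rintro rfl
        rcases Sym2.eq_iff.1 hx with ⟨h3, h4⟩ | ⟨h3, h4⟩
        · exact hne (h3.symm.trans h4)
        · exact hne (h4.symm.trans h3)
      tauto
    · tauto

lemma lower_main {s t : ℕ} (hV : Fintype.card V = s + t + 1) (hs : 0 < s)
    (hgcd : 1 < Nat.gcd s t) (G : SimpleGraph V)
    (h : IsWeaklySaturated (completeBipartiteGraph (Fin s) (Fin t)) G) :
    iE Gᶜ Finset.univ + 2 ≤ 2 * s + 2 * t := by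
  obtain ⟨-, m, c, hc0, hcm, hstep⟩ := h
  have key : ∀ k ≤ m, Sparse (c (m - k))ᶜ ∧ NoTight (Nat.gcd s t) (c (m - k))ᶜ := by
    intro k
    induction k with
    | zero =>
      intro _
      rw [Nat.sub_zero, hcm, compl_top]
      refine ⟨fun X hX => ?_, noTight_bot _ (by omega)⟩
      rw [iE_bot]; omega
    | succ k ih =>
      intro hk
      obtain ⟨h1, h2⟩ := ih (by omega)
      have hst := hstep (m - (k + 1)) (by omega)
      rw [show m - (k + 1) + 1 = m - k by omega] at hst
      obtain ⟨a, b, w, S, T, hsp⟩ := split_of_addStep hV hst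
      exact ⟨sparse_step hsp h1,
        noTight_step hgcd (Nat.gcd_dvd_left s t) (Nat.gcd_dvd_right s t) hsp h1 h2⟩
  obtain ⟨-, h2⟩ := key m le_rfl
  rw [Nat.sub_self, hc0] at h2
  obtain ⟨Y, hY, hYt⟩ := h2 {Finset.univ} ⟨by
      intro Y hY
      rw [Multiset.mem_singleton.1 hY, Finset.card_univ]; omega, by
      intro Y hY
      rw [Multiset.mem_singleton.1 hY, Finset.card_univ, hV, Nat.add_sub_cancel]
      exact dvd_add (Nat.gcd_dvd_left s t) (Nat.gcd_dvd_right s t), by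
      intro X _
      simp [fr], by simp [fr]⟩
  rw [Multiset.mem_singleton.1 hY, Finset.card_univ, hV] at hYt
  omega

end LowerBound

section UpperBound

def Reach {W V : Type*} (F : SimpleGraph W) (G : SimpleGraph V) : Prop :=
  ∃ (m : ℕ) (c : ℕ → SimpleGraph V), c 0 = G ∧ c m = ⊤ ∧ ∀ i < m, AddStep F (c i) (c (i + 1))

lemma reach_step {W V : Type*} {F : SimpleGraph W} {G G' : SimpleGraph V}
    (h : AddStep F G G') (h' : Reach F G') : Reach F G := by
  obtain ⟨m, c, h0, hm, hc⟩ := h'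
  refine ⟨m + 1, fun i => Nat.casesOn i G c, rfl, hm, ?_⟩
  intro i hi
  cases i with
  | zero => simpa [h0] using h
  | succ i => exact hc i (by omega)

lemma exists_saturated {W V : Type*} [Finite V] {F : SimpleGraph W} (hF : ∃ a b, F.Adj a b) (k : ℕ) :
    ∀ G : SimpleGraph V, G.edgeSet.ncard = k → Reach F G →
      ∃ G' : SimpleGraph V, IsWeaklySaturated F G' ∧ G'.edgeSet.ncard ≤ k := by
  induction k using Nat.strong_induction_on with
  | _ k ih =>
    intro G hk hG
    by_cases hcopy : ContainsCopy F G
    · obtain ⟨f, hf⟩ := hcopy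
      obtain ⟨a, b, hab⟩ := hF
      have hmem : s(f a, f b) ∈ G.edgeSet := hf a b hab
      set G1 := G.deleteEdges {s(f a, f b)} with hG1
      have hE : G1.edgeSet = G.edgeSet \ {s(f a, f b)} := SimpleGraph.edgeSet_deleteEdges _
      have hfin : G.edgeSet.Finite := Set.toFinite _
      have hlt : G1.edgeSet.ncard < k := by
        rw [hE, ← hk]
        exact Set.ncard_sdiff_singleton_lt_of_mem hmem
      have hr : Reach F G1 := by
        refine reach_step ⟨s(f a, f b), ?_, ?_, f, hf, a, b, hab, rfl⟩ hG
        · rw [hE]; simp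
        · rw [hE, Set.insert_sdiff_singleton, Set.insert_eq_of_mem hmem]
      obtain ⟨G', h1, h2⟩ := ih _ hlt G1 rfl hr
      exact ⟨G', h1, by omega⟩
    · exact ⟨G, ⟨hcopy, hG⟩, hk.le⟩

variable {V : Type*} [Fintype V] [DecidableEq V]

/-- the graph whose missing edges are the pairs in `P` -/
def gph (P : Finset (V × V)) : SimpleGraph V where
  Adj x y := x ≠ y ∧ (x, y) ∉ P ∧ (y, x) ∉ P
  symm := ⟨fun _ _ h => ⟨h.1.symm, h.2.2, h.2.1⟩⟩
  loopless := ⟨fun _ h => h.1 rfl⟩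

lemma addStep_of {s t : ℕ} (hV : Fintype.card V = s + t + 1) {G G' : SimpleGraph V} (a b w : V)
    (S : Finset V) (hS : S.card = s) (hw : w ∉ S) (ha : a ∈ S) (hb : b ∉ S) (hbw : b ≠ w)
    (hab : ¬ G.Adj a b) (hG' : G'.edgeSet = insert s(a, b) G.edgeSet)
    (hcr : ∀ x ∈ S, ∀ y ∉ S, y ≠ w → G'.Adj x y) :
    AddStep (completeBipartiteGraph (Fin s) (Fin t)) G G' := by
  set T : Finset V := (insert w S)ᶜ with hT
  have cT : T.card = t := by
    rw [hT, Finset.card_compl, Finset.card_insert_of_notMem hw, hS, hV]; omega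
  have mT : ∀ x, x ∈ T ↔ x ≠ w ∧ x ∉ S := by intro x; simp [hT]
  let eS : Fin s ≃ S := (S.equivFinOfCardEq hS).symm
  let eT : Fin t ≃ T := (T.equivFinOfCardEq cT).symm
  let f0 : Fin s ⊕ Fin t → V := Sum.elim (fun i => (eS i : V)) (fun j => (eT j : V))
  have hST : ∀ i j, (eS i : V) ≠ (eT j : V) := by
    intro i j hij
    have h1 := (eS i).2
    have h2 := ((mT _).1 (eT j).2).2
    rw [hij] at h1
    exact h2 h1
  have hf0 : Function.Injective f0 := by
    rintro (i | i) (j | j) hij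
    · have : eS i = eS j := Subtype.ext hij
      rw [eS.injective this]
    · exact absurd hij (hST i j)
    · exact absurd hij.symm (hST j i)
    · have : eT i = eT j := Subtype.ext hij
      rw [eT.injective this]
  refine ⟨s(a, b), hab, hG', ⟨f0, hf0⟩, ?_, Sum.inl (eS.symm ⟨a, ha⟩),
    Sum.inr (eT.symm ⟨b, (mT b).2 ⟨hbw, hb⟩⟩), by simp, by simp [f0]⟩
  have key : ∀ i j, G'.Adj (eS i : V) (eT j : V) := fun i j =>
    hcr _ (eS i).2 _ ((mT _).1 (eT j).2).2 ((mT _).1 (eT j).2).1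
  rintro (i | i) (j | j) hij
  · simp at hij
  · exact key i j
  · exact (key j i).symm
  · simp at hij

lemma rank_reach {s t : ℕ} (hV : Fintype.card V = s + t + 1) (r : V × V → ℕ) (k : ℕ) :
    ∀ P : Finset (V × V), P.card = k →
    (∀ p ∈ P, p.1 ≠ p.2 ∧ p.swap ∉ P ∧ ∃ (w : V) (S : Finset V), S.card = s ∧ w ∉ S ∧
      p.1 ≠ w ∧ p.2 ≠ w ∧ ((p.1 ∈ S ∧ p.2 ∉ S) ∨ (p.2 ∈ S ∧ p.1 ∉ S)) ∧
      ∀ q ∈ P, r p ≤ r q → q = p ∨ q.1 = w ∨ q.2 = w ∨ (q.1 ∈ S ↔ q.2 ∈ S)) →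
    Reach (completeBipartiteGraph (Fin s) (Fin t)) (gph P) := by
  induction k with
  | zero =>
    intro P hP _
    rw [Finset.card_eq_zero] at hP
    subst hP
    refine ⟨0, fun _ => ⊤, ?_, rfl, by simp⟩
    ext x y
    simp [gph]
  | succ k ih =>
    intro P hP h
    obtain ⟨p, hp, hmin⟩ := Finset.exists_min_image P r (Finset.card_pos.1 (by omega))
    have hr := ih (P.erase p) (by rw [Finset.card_erase_of_mem hp]; omega) (by
      intro q hq
      have hq' := Finset.mem_of_mem_erase hq
      obtain ⟨h1, h2, w, S, h3, h4, h5, h6, h7, h8⟩ := h q hq'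
      exact ⟨h1, fun hh => h2 (Finset.mem_of_mem_erase hh), w, S, h3, h4, h5, h6, h7,
        fun q' hq' => h8 q' (Finset.mem_of_mem_erase hq')⟩)
    refine reach_step ?_ hr
    obtain ⟨h1, h2, w, S, h3, h4, h5, h6, h7, h8⟩ := h p hp
    obtain ⟨a, b⟩ := p
    simp only [Prod.swap_prod_mk] at h1 h2 h5 h6 h7 h8 hmin
    have hedge : (gph (P.erase (a, b))).edgeSet = insert s(a, b) (gph P).edgeSet := by
      ext e
      induction e using Sym2.ind with
      | _ x y =>
        simp only [Set.mem_insert_iff, SimpleGraph.mem_edgeSet, gph, Finset.mem_erase, ne_eq,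
          Prod.mk.injEq, Sym2.eq_iff]
        constructor
        · tauto
        · rintro ((⟨rfl, rfl⟩ | ⟨rfl, rfl⟩) | hh)
          · tauto
          · tauto
          · tauto
    have hnc : ∀ x y, x ≠ w → y ≠ w → x ∈ S → y ∉ S → (gph (P.erase (a, b))).Adj x y := by
      intro x y hx hy hxS hyS
      refine ⟨fun hh => hyS (hh ▸ hxS), ?_, ?_⟩
      · intro hm
        obtain ⟨m1, m2⟩ := Finset.mem_erase.1 hm
        have := h8 _ m2 (hmin _ m2)
        simp only at this
        tauto
      · intro hm
        obtain ⟨m1, m2⟩ := Finset.mem_erase.1 hm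
        have := h8 _ m2 (hmin _ m2)
        simp only at this
        tauto
    rcases h7 with ⟨ha, hb⟩ | ⟨hb, ha⟩
    · refine addStep_of hV a b w S h3 h4 ha hb h6 ?_ hedge ?_
      · intro hh; exact hh.2.1 hp
      · intro x hx y hy hyw
        exact hnc x y (by rintro rfl; exact h4 hx) hyw hx hy
    · refine addStep_of hV b a w S h3 h4 hb ha h5 ?_ (by rw [Sym2.eq_swap]; exact hedge) ?_
      · intro hh; exact hh.2.2 hp
      · intro x hx y hy hyw
        exact hnc x y (by rintro rfl; exact h4 hx) hyw hx hy

lemma ncard_add_iE (G : SimpleGraph V) :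
    G.edgeSet.ncard + iE Gᶜ Finset.univ = (Fintype.card V).choose 2 := by
  classical
  have h1 : iE Gᶜ Finset.univ = Gᶜ.edgeSet.ncard := by
    unfold iE
    rw [← Set.ncard_coe_finset]
    congr 1
    ext e
    simp
  rw [h1, ← Set.ncard_union_eq]
  · rw [← SimpleGraph.card_edgeFinset_top_eq_card_choose_two, ← Set.ncard_coe_finset]
    congr 1
    rw [← SimpleGraph.edgeSet_sup, sup_compl_eq_top, SimpleGraph.coe_edgeFinset]
  · rw [SimpleGraph.disjoint_edgeSet]; exact disjoint_compl_right

lemma card_le_iE (P : Finset (V × V)) (h : ∀ p ∈ P, p.1 ≠ p.2 ∧ p.swap ∉ P) :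
    P.card ≤ iE (gph P)ᶜ Finset.univ := by
  classical
  unfold iE
  apply Finset.card_le_card_of_injOn (fun p => s(p.1, p.2))
  · rintro ⟨a, b⟩ hp
    have := h (a, b) hp
    have hp' : (a, b) ∈ P := hp
    simp [gph, hp']
    exact this.1
  · rintro ⟨a, b⟩ hp ⟨c, d⟩ hq hpq
    rcases Sym2.eq_iff.1 hpq with ⟨h1, h2⟩ | ⟨h1, h2⟩
    · simp at h1 h2; rw [h1, h2]
    · simp at h1 h2
      subst h1 h2
      exact absurd hq (h _ hp).2

/-- The (oriented) missing edges of the construction. -/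
def Ed (s t a b : ℕ) : Prop :=
  (a = 0 ∧ 1 ≤ b ∧ b ≤ t) ∨ (1 ≤ a ∧ b = a + 1 ∧ b ≤ t - 1) ∨ (a = t - 1 ∧ t + 1 ≤ b ∧ b ≤ t + s) ∨
  (t + 2 ≤ a ∧ b = a + 1 ∧ b ≤ t + s) ∨ (a = 0 ∧ b = t + 2)

/-- The order of addition. -/
def rk (s t a b : ℕ) : ℕ :=
  if a = 0 then (if b = t + 2 then 0 else if b = t - 1 then t + 2 else t)
  else if a = t - 1 then t + 2
  else if t + 2 ≤ a then t + 1
  else if a = s then 1 else a + 1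

set_option maxHeartbeats 4000000 in
lemma Ed_witness {s t : ℕ} (hs : 2 < s) (hst : s + 2 ≤ t) (a b : ℕ) (h : Ed s t a b) :
    ∃ (w : ℕ) (S : Finset ℕ), w < s + t + 1 ∧ (∀ x ∈ S, x < s + t + 1) ∧ S.card = s ∧ w ∉ S ∧
      a ≠ w ∧ b ≠ w ∧ ((a ∈ S ∧ b ∉ S) ∨ (b ∈ S ∧ a ∉ S)) ∧
      ∀ c d, Ed s t c d → rk s t a b ≤ rk s t c d → (c = a ∧ d = b) ∨ c = w ∨ d = w ∨
        (c ∈ S ↔ d ∈ S) := by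
  rcases h with ⟨rfl, h1, h2⟩ | ⟨h1, rfl, h2⟩ | ⟨rfl, h1, h2⟩ | ⟨h1, rfl, h2⟩ | ⟨rfl, rfl⟩
  · by_cases hb : b = t - 1
    · refine ⟨t - 2, insert 0 (Finset.Icc 1 (s - 1)), by omega, ?_, ?_, ?_, by omega, by omega, ?_, ?_⟩
      · intro x; simp; omega
      · rw [Finset.card_insert_of_notMem (by simp), Nat.card_Icc]; omega
      · simp; omega
      · left; simp; omega
      · intro c d hcd hr
        simp only [Finset.mem_insert, Finset.mem_Icc]
        unfold Ed rk at *
        split_ifs at hr <;> omega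
    · refine ⟨t - 1, insert b (Finset.Icc (t + 2) (t + s)), by omega, ?_, ?_, ?_, by omega, by omega, ?_, ?_⟩
      · intro x; simp; omega
      · rw [Finset.card_insert_of_notMem (by simp; omega), Nat.card_Icc]; omega
      · simp; omega
      · right; simp; omega
      · intro c d hcd hr
        simp only [Finset.mem_insert, Finset.mem_Icc]
        unfold Ed rk at *
        split_ifs at hr <;> omega
  · rcases lt_trichotomy a s with ha | ha | ha
    · refine ⟨0, insert t ((Finset.Icc 1 s).erase a), by omega, ?_, ?_, ?_, by omega, by omega, ?_, ?_⟩
      · intro x; simp; omega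
      · rw [Finset.card_insert_of_notMem (by simp; omega),
          Finset.card_erase_of_mem (by simp; omega), Nat.card_Icc]; omega
      · simp; omega
      · right; simp; omega
      · intro c d hcd hr
        simp only [Finset.mem_insert, Finset.mem_Icc, Finset.mem_erase]
        unfold Ed rk at *
        split_ifs at hr <;> omega
    · refine ⟨0, Finset.Icc 1 s, by omega, ?_, ?_, ?_, by omega, by omega, ?_, ?_⟩
      · intro x; simp; omega
      · rw [Nat.card_Icc]; omega
      · simp
      · left; simp; omega
      · intro c d hcd hr
        simp only [Finset.mem_Icc]
        unfold Ed rk at *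
        split_ifs at hr <;> omega
    · refine ⟨0, insert a (Finset.Icc 1 (s - 1)), by omega, ?_, ?_, ?_, by omega, by omega, ?_, ?_⟩
      · intro x; simp; omega
      · rw [Finset.card_insert_of_notMem (by simp; omega), Nat.card_Icc]; omega
      · simp; omega
      · left; simp; omega
      · intro c d hcd hr
        simp only [Finset.mem_insert, Finset.mem_Icc]
        unfold Ed rk at *
        split_ifs at hr <;> omega
  · refine ⟨t - 2, insert b (Finset.Icc 1 (s - 1)), by omega, ?_, ?_, ?_, by omega, by omega, ?_, ?_⟩
    · intro x; simp; omega
    · rw [Finset.card_insert_of_notMem (by simp; omega), Nat.card_Icc]; omega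
    · simp; omega
    · right; simp; omega
    · intro c d hcd hr
      simp only [Finset.mem_insert, Finset.mem_Icc]
      unfold Ed rk at *
      split_ifs at hr <;> omega
  · refine ⟨t - 1, Finset.Icc (t + 2) a ∪ Finset.Icc 1 (s + t + 1 - a), by omega, ?_, ?_, ?_,
      by omega, by omega, ?_, ?_⟩
    · intro x; simp; omega
    · rw [Finset.card_union_of_disjoint, Nat.card_Icc, Nat.card_Icc]
      · omega
      · rw [Finset.disjoint_left]; intro x; simp; omega
    · simp; omega
    · left; simp; omega
    · intro c d hcd hr
      simp only [Finset.mem_union, Finset.mem_Icc]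
      unfold Ed rk at *
      split_ifs at hr <;> omega
  · refine ⟨t - 1, Finset.Icc (t + 1) (t + s), by omega, ?_, ?_, ?_, by omega, by omega, ?_, ?_⟩
    · intro x; simp; omega
    · rw [Nat.card_Icc]; omega
    · simp
    · right; simp; omega
    · intro c d hcd hr
      simp only [Finset.mem_Icc]
      unfold Ed rk at *
      split_ifs at hr <;> omega

open Classical in
noncomputable def PE (s t : ℕ) : Finset (Fin (s + t + 1) × Fin (s + t + 1)) :=
  Finset.univ.filter (fun p => Ed s t p.1 p.2)

lemma mem_PE (s t : ℕ) (p) : p ∈ PE s t ↔ Ed s t p.1 p.2 := by simp [PE]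

lemma card_PE {s t : ℕ} (hs : 2 < s) (hst : s + 2 ≤ t) : 2 * s + 2 * t ≤ (PE s t).card + 3 := by
  classical
  let Q1 : Finset (ℕ × ℕ) := (Finset.Icc 1 t).image (fun b => (0, b))
  let Q2 : Finset (ℕ × ℕ) := (Finset.Icc 1 (t - 2)).image (fun a => (a, a + 1))
  let Q3 : Finset (ℕ × ℕ) := (Finset.Icc (t + 1) (t + s)).image (fun b => (t - 1, b))
  let Q4 : Finset (ℕ × ℕ) := (Finset.Icc (t + 2) (t + s - 1)).image (fun a => (a, a + 1))
  let Q5 : Finset (ℕ × ℕ) := {(0, t + 2)}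
  have m1 : ∀ a b, (a, b) ∈ Q1 ↔ a = 0 ∧ 1 ≤ b ∧ b ≤ t := by
    intro a b; simp [Q1]; omega
  have m2 : ∀ a b, (a, b) ∈ Q2 ↔ b = a + 1 ∧ 1 ≤ a ∧ a ≤ t - 2 := by
    intro a b; simp [Q2]; omega
  have m3 : ∀ a b, (a, b) ∈ Q3 ↔ a = t - 1 ∧ t + 1 ≤ b ∧ b ≤ t + s := by
    intro a b; simp [Q3]; omega
  have m4 : ∀ a b, (a, b) ∈ Q4 ↔ b = a + 1 ∧ t + 2 ≤ a ∧ a ≤ t + s - 1 := by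
    intro a b; simp [Q4]; omega
  have m5 : ∀ a b, (a, b) ∈ Q5 ↔ a = 0 ∧ b = t + 2 := by
    intro a b; simp [Q5]
  have c1 : Q1.card = t := by
    rw [Finset.card_image_of_injective _ (fun x y h => by simpa using h), Nat.card_Icc]; omega
  have c2 : Q2.card = t - 2 := by
    rw [Finset.card_image_of_injective _ (fun x y h => by simpa using h), Nat.card_Icc]; omega
  have c3 : Q3.card = s := by
    rw [Finset.card_image_of_injective _ (fun x y h => by simpa using h), Nat.card_Icc]; omega
  have c4 : Q4.card = s - 2 := by
    rw [Finset.card_image_of_injective _ (fun x y h => by simpa using h), Nat.card_Icc]; omega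
  have c5 : Q5.card = 1 := by simp [Q5]
  have hU : (Q1 ∪ (Q2 ∪ (Q3 ∪ (Q4 ∪ Q5)))).card = t + (t - 2 + (s + (s - 2 + 1))) := by
    rw [Finset.card_union_of_disjoint, Finset.card_union_of_disjoint, Finset.card_union_of_disjoint,
      Finset.card_union_of_disjoint, c1, c2, c3, c4, c5]
    all_goals
      rw [Finset.disjoint_left]
      rintro ⟨a, b⟩
      simp only [Finset.mem_union, m1, m2, m3, m4, m5]
      omega
  have hle : (Q1 ∪ (Q2 ∪ (Q3 ∪ (Q4 ∪ Q5)))).card ≤ (PE s t).card := by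
    refine le_trans (Finset.card_le_card (t := (PE s t).image (fun p => (p.1.val, p.2.val))) ?_)
      Finset.card_image_le
    rintro ⟨a, b⟩ hab
    simp only [Finset.mem_union, m1, m2, m3, m4, m5] at hab
    have hE : Ed s t a b := by unfold Ed; omega
    rw [Finset.mem_image]
    exact ⟨(⟨a, by omega⟩, ⟨b, by omega⟩), (mem_PE _ _ _).2 hE, rfl⟩
  omega

lemma PE_ok {s t : ℕ} (hs : 2 < s) (hst : s + 2 ≤ t) :
    ∀ p ∈ PE s t, p.1 ≠ p.2 ∧ p.swap ∉ PE s t := by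
  rintro ⟨a, b⟩ hp
  rw [mem_PE] at hp ⊢
  simp only [Prod.swap_prod_mk, ne_eq, Fin.ext_iff] at hp ⊢
  unfold Ed at *
  constructor <;> omega

lemma upper_reach {s t : ℕ} (hs : 2 < s) (hst : s + 2 ≤ t) :
    Reach (completeBipartiteGraph (Fin s) (Fin t)) (gph (PE s t)) := by
  refine rank_reach (V := Fin (s + t + 1)) (by simp) (fun p => rk s t p.1 p.2) _ (PE s t) rfl ?_
  intro p hp
  obtain ⟨h1, h2⟩ := PE_ok hs hst p hp
  refine ⟨h1, h2, ?_⟩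
  rw [mem_PE] at hp
  obtain ⟨w, S, hw, hS, hc, hwS, haw, hbw, hor, hq⟩ := Ed_witness hs hst _ _ hp
  refine ⟨⟨w, hw⟩, S.attachFin hS, by simpa using hc, by simpa using hwS, ?_, ?_,
    by simpa using hor, ?_⟩
  · simpa [Fin.ext_iff] using haw
  · simpa [Fin.ext_iff] using hbw
  · intro q hqm hr
    have := hq _ _ ((mem_PE _ _ _).1 hqm) hr
    simpa [Fin.ext_iff, Prod.ext_iff] using this

end UpperBound

/-- For `t > s > 2` with `gcd(s,t) > 1`,
`C(s+t+1,2) − (2s+2t−2) ≤ wsat(s+t+1, K_{s,t}) ≤ C(s+t+1,2) − (2s+2t−3)`. -/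
theorem wsat_Kst_not_coprime (s t : ℕ) (hs : 2 < s) (hst : s < t) (hgcd : 1 < Nat.gcd s t) :
    ((s + t + 1).choose 2 : ℤ) - (2 * s + 2 * t - 2) ≤
      (wsat (s + t + 1) (completeBipartiteGraph (Fin s) (Fin t)) : ℤ) ∧
    (wsat (s + t + 1) (completeBipartiteGraph (Fin s) (Fin t)) : ℤ) ≤
      ((s + t + 1).choose 2 : ℤ) - (2 * s + 2 * t - 3) := by
  have hst2 : s + 2 ≤ t := by
    by_contra hh
    have : t = s + 1 := by omega
    subst this
    simp at hgcd
  obtain ⟨G', hG', hle⟩ := exists_saturated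
    (F := completeBipartiteGraph (Fin s) (Fin t))
    ⟨Sum.inl ⟨0, by omega⟩, Sum.inr ⟨0, by omega⟩, by simp⟩ _ (gph (PE s t)) rfl (upper_reach hs hst2)
  have hcount := ncard_add_iE (gph (PE s t))
  have h1 := card_le_iE (PE s t) (PE_ok hs hst2)
  have h2 := card_PE hs hst2
  rw [Fintype.card_fin] at hcount
  have hmem : G'.edgeSet.ncard ∈ {m | ∃ G : SimpleGraph (Fin (s + t + 1)),
      IsWeaklySaturated (completeBipartiteGraph (Fin s) (Fin t)) G ∧ G.edgeSet.ncard = m} :=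
    ⟨G', hG', rfl⟩
  constructor
  · obtain ⟨G, hG, hGm⟩ := Nat.sInf_mem ⟨_, hmem⟩
    have h3 := ncard_add_iE G
    have h4 := lower_main (by simp) (by omega) hgcd G hG
    rw [Fintype.card_fin] at h3
    unfold wsat
    rw [← hGm]
    omega
  · have h3 : wsat (s + t + 1) (completeBipartiteGraph (Fin s) (Fin t)) ≤ G'.edgeSet.ncard :=
      Nat.sInf_le hmem
    omega
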